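/- Let Σ = (A,b) be a system of size (n,1) over a commutative von Neumann regular ring R, and suppose Σ is feedback equivalent to the canonical form (Ã, B̃) with B̃ = d_1·e⁽¹⁾ and Ã = S + A*, where d_1 | d_2 | … | d_n are idempotents, S ∈ R^{n×n} has S_{i+1,i} = d_{i+1} and zeros elsewhere, and A* = M_0 + … + M_{n−1} with each M_i vanishing outside the lower-right (n−i)×(n−i) block and satisfying M_i = d_i(1−d_{i+1})·M_i (d_0 := 1). Then for each k = 1,…,n, there is an isomorphism of R-modules N_k^Σ ≅ d_1R ⊕ d_2R ⊕ … ⊕ d_kR; in fact N_k^{(Ã,B̃)} = d_1e⁽¹⁾R + … + d_ke⁽ᵏ⁾R. -/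

import Mathlib

open Matrix

/-- Feedback equivalence of linear systems `(A, B)` and `(A', B')`:
`A' = P(A + BK)P⁻¹` and `B' = PBQ` for some invertible `P`, `Q` and some `K`. -/
def FeedbackEquiv {n m : Type*} [Fintype n] [DecidableEq n] [Fintype m] [DecidableEq m]
    (R : Type*) [CommRing R]
    (A : Matrix n n R) (B : Matrix n m R)
    (A' : Matrix n n R) (B' : Matrix n m R) : Prop :=
  ∃ (P : GL n R) (Q : GL m R) (K : Matrix m n R),
    A' = (P : Matrix n n R) * (A + B * K) * ((P⁻¹ : GL n R) : Matrix n n R) ∧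
    B' = (P : Matrix n n R) * B * (Q : Matrix m m R)

/-- The module `N_k` of states reachable in at most `k` steps: the span of the
columns of `[B | AB | ... | A^(k-1)B]`. -/
def Nmod {n m : Type*} [Fintype n] [DecidableEq n] [Fintype m]
    (R : Type*) [CommRing R]
    (A : Matrix n n R) (B : Matrix n m R) (k : ℕ) : Submodule R (n → R) :=
  Submodule.span R { x : n → R | ∃ i < k, ∃ j : m, x = fun p => (A ^ i * B) p j }

/-- If `P` intertwines `(A, B)` with `(A', B')` up to feedback, then it maps the states reachable
in `k` steps for `(A, B)` to those for `(A', B')`. -/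
theorem Nmod_le_comap_mulVecLin {n m m' R : Type*} [Fintype n] [DecidableEq n]
    [Fintype m] [Fintype m'] [CommRing R]
    {A A' P : Matrix n n R} {B : Matrix n m R} {B' : Matrix n m' R}
    {G : Matrix m' m R} {L : Matrix m' n R}
    (hB : P * B = B' * G) (hA : P * A = A' * P + B' * L) (k : ℕ) :
    Nmod R A B k ≤ (Nmod R A' B' k).comap P.mulVecLin := by
  have pow_mem (i : ℕ) (hi : i < k) (u : m' → R) : (A' ^ i * B') *ᵥ u ∈ Nmod R A' B' k := by
    rw [mulVec_eq_sum]
    refine Submodule.sum_mem _ fun j _ ↦ ?_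
    rw [op_smul_eq_smul]
    exact Submodule.smul_mem _ _ (Submodule.subset_span ⟨i, hi, j, rfl⟩)
  have shift (i : ℕ) : ∃ F : ℕ → Matrix m' m R,
      P * (A ^ i * B) = ∑ l ∈ Finset.range (i + 1), A' ^ l * B' * F l := by
    induction i with
    | zero => exact ⟨fun _ ↦ G, by simp [hB]⟩
    | succ i ih =>
      obtain ⟨F, hF⟩ := ih
      refine ⟨fun l ↦ l.casesOn (L * (A ^ i * B)) F, ?_⟩
      rw [Finset.sum_range_succ', pow_succ', Matrix.mul_assoc, ← Matrix.mul_assoc P, hA,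
        Matrix.add_mul, Matrix.mul_assoc A', hF, Matrix.mul_sum]
      simp [pow_succ', Matrix.mul_assoc]
  refine Submodule.span_le.2 ?_
  rintro _ ⟨i, hi, j, rfl⟩
  obtain ⟨F, hF⟩ := shift i
  have key : P *ᵥ (fun p ↦ (A ^ i * B) p j) =
      ∑ l ∈ Finset.range (i + 1), (A' ^ l * B') *ᵥ fun q ↦ F l q j := by
    ext p
    have h := congrFun (congrFun hF p) j
    rw [Matrix.sum_apply] at h
    rw [Finset.sum_apply]
    exact h
  change P *ᵥ (fun p ↦ (A ^ i * B) p j) ∈ Nmod R A' B' k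
  rw [key]
  exact Submodule.sum_mem _ fun l hl ↦ pow_mem l (by have := Finset.mem_range.1 hl; omega) _

/-- The modules `N_k` of feedback equivalent systems are isomorphic. -/
theorem FeedbackEquiv.nonempty_Nmod_linearEquiv {n m R : Type*} [Fintype n] [DecidableEq n]
    [Fintype m] [DecidableEq m] [CommRing R] {A A' : Matrix n n R} {B B' : Matrix n m R}
    (h : FeedbackEquiv R A B A' B') (k : ℕ) :
    Nonempty (Nmod R A B k ≃ₗ[R] Nmod R A' B' k) := by
  obtain ⟨P, Q, K, rfl, rfl⟩ := h
  have hP : (P : Matrix n n R) * (P⁻¹ : GL n R) = 1 := P.mul_inv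
  have hP' : ((P⁻¹ : GL n R) : Matrix n n R) * P = 1 := P.inv_mul
  have hQ : (Q : Matrix m m R) * (Q⁻¹ : GL m R) = 1 := Q.mul_inv
  generalize (P : Matrix n n R) = U, ((P⁻¹ : GL n R) : Matrix n n R) = V,
    (Q : Matrix m m R) = W, ((Q⁻¹ : GL m R) : Matrix m m R) = Z at hP hP' hQ ⊢
  have forward : Nmod R A B k ≤
      (Nmod R (U * (A + B * K) * V) (U * B * W) k).comap U.mulVecLin :=
    Nmod_le_comap_mulVecLin (G := Z) (L := -(Z * K))
      (by rw [Matrix.mul_assoc, hQ, Matrix.mul_one])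
      (by
        rw [Matrix.mul_assoc _ V U, hP', Matrix.mul_one, Matrix.mul_neg,
          ← Matrix.mul_assoc (U * B * W), Matrix.mul_assoc (U * B), hQ,
          Matrix.mul_one, Matrix.mul_add, Matrix.mul_assoc, add_neg_cancel_right]) k
  have backward : Nmod R (U * (A + B * K) * V) (U * B * W) k ≤
      (Nmod R A B k).comap V.mulVecLin :=
    Nmod_le_comap_mulVecLin (G := W) (L := K * V)
      (by rw [← Matrix.mul_assoc, ← Matrix.mul_assoc, hP', Matrix.one_mul])
      (by
        rw [← Matrix.mul_assoc, ← Matrix.mul_assoc, hP', Matrix.one_mul, Matrix.add_mul,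
          Matrix.mul_assoc B]) k
  refine ⟨LinearEquiv.ofLinearMap (LinearMap.restrict _ forward) (LinearMap.restrict _ backward)
    ?_ ?_⟩
  · ext x : 2
    simp [LinearMap.restrict_apply, hP]
  · ext x : 2
    simp [LinearMap.restrict_apply, hP']

/-- The span of the first `k` scaled basis vectors `c j • e j` is the product of the principal
ideals generated by the `c j`. -/
theorem nonempty_span_scaled_basis_linearEquiv {R : Type*} [CommRing R] {n k : ℕ} (hk : k ≤ n)
    (c : ℕ → R) :
    Nonempty (Submodule.span R (Set.range fun j : Fin k ↦
        (fun p : Fin n ↦ if (p : ℕ) = (j : ℕ) then c j else 0)) ≃ₗ[R]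
      ((j : Fin k) → ↥(Ideal.span ({c j} : Set R)))) := by
  let f : ((j : Fin k) → ↥(Ideal.span ({c j} : Set R))) →ₗ[R] (Fin n → R) :=
    { toFun x p := if h : (p : ℕ) < k then (x ⟨p, h⟩ : R) else 0
      map_add' x y := by ext p; by_cases h : (p : ℕ) < k <;> simp [h]
      map_smul' r x := by ext p; by_cases h : (p : ℕ) < k <;> simp [h] }
  have f_apply (x) (p : Fin n) : f x p = if h : (p : ℕ) < k then (x ⟨p, h⟩ : R) else 0 := rfl
  have f_injective : Function.Injective f := fun x y h ↦ by
    ext j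
    simpa [f_apply] using congrFun h (Fin.castLE hk j)
  have f_range : LinearMap.range f = Submodule.span R (Set.range fun j : Fin k ↦
      (fun p : Fin n ↦ if (p : ℕ) = (j : ℕ) then c j else 0)) := by
    apply le_antisymm
    · rintro _ ⟨x, rfl⟩
      choose a ha using fun j ↦ Ideal.mem_span_singleton'.1 (x j).2
      have hx : f x = ∑ j : Fin k, a j •
          (fun p : Fin n ↦ if (p : ℕ) = (j : ℕ) then c j else 0) := by
        ext p
        rw [f_apply, Finset.sum_apply]
        split_ifs with h
        · rw [Finset.sum_eq_single ⟨p, h⟩]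
          · simp [ha]
          · intro j _ hj
            have : (p : ℕ) ≠ j := fun e ↦ hj (Fin.ext e.symm)
            simp [this]
          · simp
        · refine (Finset.sum_eq_zero fun j _ ↦ ?_).symm
          have : (p : ℕ) ≠ j := by omega
          simp [this]
      rw [hx]
      exact Submodule.sum_mem _ fun j _ ↦
        Submodule.smul_mem _ _ (Submodule.subset_span ⟨j, rfl⟩)
    · rw [Submodule.span_le]
      rintro _ ⟨j, rfl⟩
      refine ⟨Pi.single j ⟨c j, Ideal.mem_span_singleton_self _⟩, ?_⟩
      ext p
      rw [f_apply]
      by_cases hp : (p : ℕ) = j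
      · have h : (p : ℕ) < k := hp ▸ j.2
        obtain rfl : ⟨p, h⟩ = j := Fin.ext hp
        simp [h]
      · split_ifs with h
        · have hj : (⟨p, h⟩ : Fin k) ≠ j := fun e ↦ hp (congrArg Fin.val e)
          simp [Pi.single_eq_of_ne hj, hp]
        · simp [hp]
  exact ⟨((LinearEquiv.ofInjective f f_injective).trans (LinearEquiv.ofEq _ _ f_range)).symm⟩

/-- Along a finite divisibility chain of idempotents, earlier terms absorb later ones. -/
theorem mul_eq_right_of_idempotent_chain {R : Type*} [CommRing R] {n : ℕ} {d : ℕ → R}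
    (hidem : ∀ j : ℕ, 1 ≤ j → j ≤ n → IsIdempotentElem (d j))
    (hchain : ∀ j : ℕ, 1 ≤ j → j < n → d j * d (j + 1) = d (j + 1))
    {i j : ℕ} (hi : 1 ≤ i) (hij : i ≤ j) (hj : j ≤ n) : d i * d j = d j := by
  induction j, hij using Nat.le_induction with
  | base => exact hidem i hi hj
  | succ j hij ih => rw [← hchain j (by omega) hj, ← mul_assoc, ih (by omega)]

/-- if a single-input system `(A, b)` over a commutative von
Neumann regular ring is feedback equivalent to the canonical form `(Ã, B̃)`
(`B̃ = d₁·e⁽¹⁾`, `Ã = S + M₀ + ⋯ + M_{n-1}`, with a chain of idempotents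
`d₁ | ⋯ | dₙ`, `d 0 = 1` by convention), then for every `k = 1, …, n` the module
`N_k` of `(A, b)` is isomorphic to `d₁R ⊕ ⋯ ⊕ d_kR`, and indeed
`N_k` of `(Ã, B̃)` equals `d₁e⁽¹⁾R + ⋯ + d_ke⁽ᵏ⁾R`. -/
theorem single_input_Nk_structure
    {R : Type*} [CommRing R]
    (hreg : ∀ a : R, ∃ x : R, a ^ 2 * x = a)
    {n : ℕ}
    (A : Matrix (Fin n) (Fin n) R) (b : Matrix (Fin n) (Fin 1) R)
    (d : ℕ → R)
    (hd0 : d 0 = 1)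
    (hidem : ∀ j : ℕ, 1 ≤ j → j ≤ n → IsIdempotentElem (d j))
    (hchain : ∀ j : ℕ, 1 ≤ j → j < n → d j * d (j + 1) = d (j + 1))
    (M : Fin n → Matrix (Fin n) (Fin n) R)
    (hMblock : ∀ (i p q : Fin n), ((p : ℕ) < (i : ℕ) ∨ (q : ℕ) < (i : ℕ)) → M i p q = 0)
    (hMd : ∀ i : Fin n, M i = (d (i : ℕ) * (1 - d ((i : ℕ) + 1))) • M i)
    (Atil : Matrix (Fin n) (Fin n) R)
    (hAtil : Atil = (Matrix.of fun p q : Fin n =>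
        if (p : ℕ) = (q : ℕ) + 1 then d ((p : ℕ) + 1) else 0) + ∑ i, M i)
    (Btil : Matrix (Fin n) (Fin 1) R)
    (hBtil : Btil = Matrix.of fun (p : Fin n) (_ : Fin 1) =>
        if (p : ℕ) = 0 then d 1 else 0)
    (hfe : FeedbackEquiv R A b Atil Btil) :
    ∀ k : ℕ, 1 ≤ k → k ≤ n →
      Nonempty ((Nmod R A b k) ≃ₗ[R]
        ((j : Fin k) → ↥(Ideal.span ({d ((j : ℕ) + 1)} : Set R)))) ∧
      Nmod R Atil Btil k =
        Submodule.span R (Set.range fun j : Fin k =>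
          (fun p : Fin n => if (p : ℕ) = (j : ℕ) then d ((j : ℕ) + 1) else 0)) := by
  have mul_chain {i j : ℕ} (hi : 1 ≤ i) (hij : i ≤ j) (hj : j ≤ n) : d i * d j = d j :=
    mul_eq_right_of_idempotent_chain hidem hchain hi hij hj
  have M_mul (i p q : Fin n) : M i p q * d ((q : ℕ) + 1) = 0 := by
    by_cases hqi : (q : ℕ) < i
    · rw [hMblock i p q (Or.inr hqi), zero_mul]
    · have h := congrFun (congrFun (hMd i) p) q
      rw [Matrix.smul_apply, smul_eq_mul] at h
      rw [h]
      linear_combination (-d (i : ℕ) * M i p q) *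
        mul_chain (i := (i : ℕ) + 1) (j := (q : ℕ) + 1) (by omega) (by omega) q.2
  have column (i : ℕ) (hi : i < n) (p : Fin n) (j : Fin 1) :
      (Atil ^ i * Btil) p j = if (p : ℕ) = i then d (i + 1) else 0 := by
    induction i generalizing p with
    | zero => simp [hBtil]
    | succ i ih =>
      rw [pow_succ', Matrix.mul_assoc, Matrix.mul_apply,
        Finset.sum_eq_single (⟨i, by omega⟩ : Fin n)]
      · rw [ih (by omega), if_pos rfl, hAtil, Matrix.add_apply, Matrix.sum_apply, add_mul,
          Finset.sum_mul, Finset.sum_eq_zero fun l _ ↦ M_mul l p ⟨i, by omega⟩, add_zero,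
          Matrix.of_apply, ite_mul, zero_mul]
        split_ifs with hp
        · rw [hp, mul_comm]
          exact hchain (i + 1) (by omega) hi
        · rfl
      · intro q _ hq
        rw [ih (by omega), if_neg fun e ↦ hq (Fin.ext e), mul_zero]
      · simp
  intro k _ hk
  have canonical : Nmod R Atil Btil k = Submodule.span R (Set.range fun j : Fin k =>
      (fun p : Fin n => if (p : ℕ) = (j : ℕ) then d ((j : ℕ) + 1) else 0)) := by
    refine congrArg (Submodule.span R) (Set.ext fun x ↦ ⟨?_, ?_⟩)
    · rintro ⟨i, hi, j, rfl⟩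
      exact ⟨⟨i, hi⟩, funext fun p ↦ (column i (by omega) p j).symm⟩
    · rintro ⟨i, rfl⟩
      exact ⟨i, i.2, 0, funext fun p ↦ (column i (by omega) p 0).symm⟩
  obtain ⟨e⟩ := hfe.nonempty_Nmod_linearEquiv k
  obtain ⟨g⟩ := nonempty_span_scaled_basis_linearEquiv hk fun j ↦ d (j + 1)
  exact ⟨⟨e.trans ((LinearEquiv.ofEq _ _ canonical).trans g)⟩, canonical⟩
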